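/- arXiv:math/0512183 — 5 statements merged into one kernel-verified Lean document; each statement's English description precedes it below -/
import Mathlib

section
/- Every p×p complex symmetric matrix Z admits a Takagi factorization: there exist a p×p unitary matrix U and nonnegative real numbers λ₁ ≥ λ₂ ≥ ⋯ ≥ λ_p ≥ 0 such that Z = Uᵗ · diag(λ₁, …, λ_p) · U, where Uᵗ denotes the transpose of U. -/
open Matrix

section SymmetricBilinearForm

variable {E : Type*} [NormedAddCommGroup E] [InnerProductSpace ℂ E]

/-- At a unit vector `v` maximizing `Re B(x, x) / ‖x‖ ^ 2`, the first variation of `Re B` vanishes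
in every direction that is real-orthogonal to `v`. -/
lemma re_apply_eq_zero_of_forall_re_apply_self_le (B : E →ₗ[ℂ] E →ₗ[ℂ] ℂ)
    (hB : ∀ x y, B x y = B y x) {v : E} (hv : ‖v‖ = 1)
    (hmax : ∀ x, (B x x).re ≤ (B v v).re * ‖x‖ ^ 2) {w : E} (hw : (inner ℂ v w).re = 0) :
    (B v w).re = 0 := by
  set K := (B v v).re * ‖w‖ ^ 2 - (B w w).re with hK
  have key : ∀ t : ℝ, 2 * t * (B v w).re ≤ t ^ 2 * K := by
    intro t
    have h := hmax (v + (t : ℂ) • w)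
    have hn : ‖v + (t : ℂ) • w‖ ^ 2 = 1 + t ^ 2 * ‖w‖ ^ 2 := by
      rw [@norm_add_sq ℂ, inner_smul_right, hv, norm_smul, mul_pow]
      simp [hw]
    rw [hn] at h
    simp only [map_add, map_smul, LinearMap.add_apply, LinearMap.smul_apply, smul_eq_mul,
      Complex.add_re, Complex.re_ofReal_mul, hB w v] at h
    rw [hK]
    linarith
  have hK0 : 0 ≤ K := by
    have := hmax w
    linarith
  have h := key ((B v w).re / (K + 1))
  have hpos : 0 < K + 1 := by linarith
  have h2 : 2 * (B v w).re ^ 2 * (K + 1) ≤ (B v w).re ^ 2 * K := by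
    field_simp at h
    linarith
  have h3 : (B v w).re ^ 2 ≤ 0 := by nlinarith [sq_nonneg (B v w).re]
  exact pow_eq_zero_iff two_ne_zero |>.mp (le_antisymm h3 (sq_nonneg _))

variable [FiniteDimensional ℂ E]

lemma exists_norm_eq_one_forall_re_apply_self_le [Nontrivial E] (B : E →ₗ[ℂ] E →ₗ[ℂ] ℂ) :
    ∃ v : E, ‖v‖ = 1 ∧ ∀ x, (B x x).re ≤ (B v v).re * ‖x‖ ^ 2 := by
  have : ProperSpace E := FiniteDimensional.proper ℂ E
  have hcont : Continuous fun x : E => (B x x).re := by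
    let C : E →ₗ[ℂ] E →L[ℂ] ℂ := LinearMap.toContinuousLinearMap.toLinearMap ∘ₗ B
    have hC : Continuous C := C.continuous_of_finiteDimensional
    exact Complex.continuous_re.comp (hC.clm_apply continuous_id)
  obtain ⟨u, hu⟩ := exists_norm_eq E zero_le_one
  obtain ⟨v, hv, hmax⟩ := (isCompact_sphere (0 : E) 1).exists_isMaxOn ⟨u, by simpa using hu⟩
    hcont.continuousOn
  refine ⟨v, by simpa using hv, fun x => ?_⟩
  by_cases hx : x = 0
  · simp [hx]
  have hx' : ‖x‖ ≠ 0 := norm_ne_zero_iff.mpr hx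
  have h : (B (((‖x‖⁻¹ : ℝ) : ℂ) • x) (((‖x‖⁻¹ : ℝ) : ℂ) • x)).re ≤ (B v v).re :=
    hmax (by simp [norm_smul, hx'])
  simp only [map_smul, LinearMap.smul_apply, smul_eq_mul, Complex.re_ofReal_mul] at h
  field_simp at h
  linarith

/-- A symmetric bilinear form on a nonzero finite-dimensional complex inner product space has a
unit vector `v` that is `B`-orthogonal to its orthogonal complement, at which `B v v` is
a nonnegative real dominating `Re B` on the unit ball. -/
lemma exists_unit_vector_apply_eq_zero_of_inner_eq_zero [Nontrivial E] (B : E →ₗ[ℂ] E →ₗ[ℂ] ℂ)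
    (hB : ∀ x y, B x y = B y x) :
    ∃ (v : E) (m : ℝ), ‖v‖ = 1 ∧ 0 ≤ m ∧ B v v = m ∧ (∀ x, (B x x).re ≤ m * ‖x‖ ^ 2) ∧
      ∀ w, inner ℂ v w = 0 → B v w = 0 := by
  obtain ⟨v, hv, hmax⟩ := exists_norm_eq_one_forall_re_apply_self_le B
  have hcrit {w : E} := re_apply_eq_zero_of_forall_re_apply_self_le B hB hv hmax (w := w)
  refine ⟨v, (B v v).re, hv, ?_, ?_, hmax, fun w hw => ?_⟩
  · have h := hmax (Complex.I • v)
    simp only [map_smul, LinearMap.smul_apply, smul_eq_mul, ← mul_assoc, Complex.I_mul_I,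
      norm_smul, hv] at h
    simp at h
    linarith
  · have h := hcrit (w := Complex.I • v) (by
      rw [inner_smul_right, inner_self_eq_norm_sq_to_K, hv]
      simp)
    apply Complex.ext <;> simp_all
  · have h := hcrit (w := w) (by simp [hw])
    have h' := hcrit (w := Complex.I • w) (by simp [hw])
    apply Complex.ext <;> simp_all

end SymmetricBilinearForm

/-- A symmetric bilinear form on a finite-dimensional complex inner product space is diagonal in
some orthonormal basis, with nonnegative real entries in decreasing order. -/
lemma exists_orthonormalBasis_apply_eq_diagonal (n : ℕ) :
    ∀ {E : Type*} [NormedAddCommGroup E] [InnerProductSpace ℂ E] [FiniteDimensional ℂ E],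
      Module.finrank ℂ E = n → ∀ B : E →ₗ[ℂ] E →ₗ[ℂ] ℂ, (∀ x y, B x y = B y x) →
      ∃ (b : OrthonormalBasis (Fin n) ℂ E) (lam : Fin n → ℝ), (∀ i, 0 ≤ lam i) ∧ Antitone lam ∧
        ∀ i j, B (b i) (b j) = Matrix.diagonal (fun i => (lam i : ℂ)) i j := by
  induction n with
  | zero =>
    intro E _ _ _ hE B hB
    exact ⟨(stdOrthonormalBasis ℂ E).reindex (finCongr hE), 0, fun i => i.elim0,
      fun i => i.elim0, fun i => i.elim0⟩
  | succ n ih =>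
    intro E _ _ _ hE B hB
    have : Nontrivial E := Module.nontrivial_of_finrank_pos (R := ℂ) (by omega)
    obtain ⟨v, m, hv, hm, hvv, hmax, hperp⟩ :=
      exists_unit_vector_apply_eq_zero_of_inner_eq_zero B hB
    have hv0 : v ≠ 0 := by
      rintro rfl
      simp at hv
    have : Fact (Module.finrank ℂ E = n + 1) := ⟨hE⟩
    obtain ⟨b, lam, hlam, hanti, hdiag⟩ := ih
      (Submodule.finrank_orthogonal_span_singleton (𝕜 := ℂ) hv0)
      (B.compl₁₂ (ℂ ∙ v)ᗮ.subtype (ℂ ∙ v)ᗮ.subtype) (fun x y => hB x y)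
    have hdiag' : ∀ i j, B (b i) (b j) = Matrix.diagonal (fun i => (lam i : ℂ)) i j := hdiag
    have hvb : ∀ i, inner ℂ v (b i : E) = 0 := fun i =>
      Submodule.mem_orthogonal_singleton_iff_inner_right.mp (b i).2
    have hbb : ∀ i j, inner ℂ (b i : E) (b j : E) = if i = j then 1 else 0 := fun i j =>
      orthonormal_iff_ite.mp b.orthonormal i j
    have hon : Orthonormal ℂ (Fin.cons v (fun i => (b i : E)) : Fin (n + 1) → E) := by
      rw [orthonormal_iff_ite]
      intro i j
      cases i using Fin.cases <;> cases j using Fin.cases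
      · simp [inner_self_eq_norm_sq_to_K, hv]
      · simp [hvb, (Fin.succ_ne_zero _).symm]
      · simp [inner_eq_zero_symm.mp (hvb _)]
      · simp [hbb]
    have hspan : ⊤ ≤ Submodule.span ℂ
        (Set.range (Fin.cons v (fun i => (b i : E)) : Fin (n + 1) → E)) :=
      (hon.linearIndependent.span_eq_top_of_card_eq_finrank' (by simp [hE])).ge
    refine ⟨OrthonormalBasis.mk hon hspan, Fin.cons m lam, ?_, ?_, ?_⟩
    · intro i
      cases i using Fin.cases <;> simp [hm, hlam]
    · intro i j hij
      cases i using Fin.cases with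
      | zero =>
        cases j using Fin.cases with
        | zero => simp
        | succ j =>
          have h := hmax (b j : E)
          have hnorm : ‖(b j : E)‖ = 1 := b.orthonormal.1 j
          rw [hdiag', hnorm] at h
          simpa using h
      | succ i =>
        cases j using Fin.cases with
        | zero => simp at hij
        | succ j => simpa using hanti (Fin.succ_le_succ_iff.mp hij)
    · intro i j
      rw [OrthonormalBasis.coe_mk]
      cases i using Fin.cases <;> cases j using Fin.cases
      · simp [hvv]
      · simp [hperp _ (hvb _), (Fin.succ_ne_zero _).symm]
      · simp [hB _ v, hperp _ (hvb _)]
      · simp [hdiag', Matrix.diagonal_apply]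

/-- **Takagi factorization.** Every `p × p` complex symmetric matrix `Z` can be written
as `Z = Uᵀ * diagonal λ * U` with `U` unitary and `λ₁ ≥ λ₂ ≥ ⋯ ≥ λ_p ≥ 0`. -/
theorem takagi_factorization (p : ℕ) (Z : Matrix (Fin p) (Fin p) ℂ) (hZ : Z.IsSymm) :
    ∃ (U : Matrix (Fin p) (Fin p) ℂ) (lam : Fin p → ℝ),
      U ∈ Matrix.unitaryGroup (Fin p) ℂ ∧
      (∀ i, 0 ≤ lam i) ∧
      (∀ i j : Fin p, i ≤ j → lam j ≤ lam i) ∧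
      Z = Uᵀ * Matrix.diagonal (fun i => (lam i : ℂ)) * U := by
  let e : EuclideanSpace ℂ (Fin p) →ₗ[ℂ] (Fin p → ℂ) :=
    (WithLp.linearEquiv 2 ℂ (Fin p → ℂ)).toLinearMap
  let B : EuclideanSpace ℂ (Fin p) →ₗ[ℂ] EuclideanSpace ℂ (Fin p) →ₗ[ℂ] ℂ :=
    (Matrix.toLinearMap₂' ℂ Z).compl₁₂ e e
  have hBapply : ∀ x y, B x y = x.ofLp ⬝ᵥ Z *ᵥ y.ofLp := fun x y =>
    Matrix.toLinearMap₂'_apply' Z _ _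
  have hB : ∀ x y, B x y = B y x := fun x y => by
    rw [hBapply, hBapply, Matrix.dotProduct_mulVec, ← Matrix.mulVec_transpose, hZ.eq,
      dotProduct_comm]
  obtain ⟨b, lam, hlam, hanti, hdiag⟩ :=
    exists_orthonormalBasis_apply_eq_diagonal p (by simp) B hB
  let V : Matrix (Fin p) (Fin p) ℂ := Matrix.of fun i j => b j i
  have hVV : Vᴴ * V = 1 := by
    ext i j
    have h := orthonormal_iff_ite.mp b.orthonormal i j
    rw [Matrix.one_apply, ← h, PiLp.inner_apply]
    simp [Matrix.mul_apply, V, mul_comm]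
  have hVV' : V * Vᴴ = 1 := mul_eq_one_comm.mp hVV
  have hD : Vᵀ * Z * V = Matrix.diagonal (fun i => (lam i : ℂ)) := by
    ext i j
    rw [← hdiag, hBapply, Matrix.mul_assoc]
    rfl
  refine ⟨Vᴴ, lam, ?_, hlam, fun i j hij => hanti hij, ?_⟩
  · rw [Matrix.mem_unitaryGroup_iff, Matrix.star_eq_conjTranspose,
      Matrix.conjTranspose_conjTranspose, hVV]
  · have hT : Vᴴᵀ * Vᵀ = 1 := by
      rw [← Matrix.transpose_mul, hVV', Matrix.transpose_one]
    rw [← hD]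
    calc Z = (Vᴴᵀ * Vᵀ) * Z * (V * Vᴴ) := by rw [hT, hVV', Matrix.one_mul, Matrix.mul_one]
      _ = Vᴴᵀ * (Vᵀ * Z * V) * Vᴴ := by simp only [Matrix.mul_assoc]
end

section
/- Let Z and Z₀ belong to R_II(p) and let A be a p×p complex matrix satisfying Āᵗ·A = (I − Z₀·Z₀ᴴ)^{−1}, where Ā denotes the entrywise complex conjugate of A. Then Z* = A·(Z − Z₀)·(I − Z₀ᴴ·Z)^{−1}·Ā^{−1} is a symmetric matrix with I − Z*·(Z*)ᴴ positive definite, i.e. Z* ∈ R_II(p); moreover Z* = 0 when Z = Z₀. -/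
open Matrix ComplexOrder

/-- The second type classical domain `R_II(p)`: `p × p` complex symmetric matrices `Z`
with `I - Z * Zᴴ` positive definite. -/
def RII (p : ℕ) (Z : Matrix (Fin p) (Fin p) ℂ) : Prop :=
  Z.IsSymm ∧ (1 - Z * Zᴴ).PosDef

section Ring

variable {R : Type*} [Ring R] {W V S X : R}

/-- A left inverse `S` of `1 - W V` is determined by a right inverse `X` of `1 - V W`. -/
theorem inv_one_sub_mul_eq (hS : S * (1 - W * V) = 1)
    (hX' : (1 - V * W) * X = 1) : S = 1 + W * X * V := by
  have h : (1 - W * V) * (1 + W * X * V) = 1 := by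
    calc (1 - W * V) * (1 + W * X * V)
        = 1 - W * V + W * ((1 - V * W) * X) * V := by noncomm_ring
      _ = 1 := by rw [hX']; noncomm_ring
  calc S = S * ((1 - W * V) * (1 + W * X * V)) := by rw [h, mul_one]
    _ = 1 + W * X * V := by rw [← mul_assoc, hS, one_mul]

theorem mobius_symm_identity (hS : S = 1 + W * X * V) (hX' : (1 - V * W) * X = 1)
    (hX : X * (1 - V * W) = 1) (Z : R) :
    (1 - Z * V) * S * (Z - W) = (Z - W) * X * (1 - V * Z) := by
  subst hS
  calc (1 - Z * V) * (1 + W * X * V) * (Z - W)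
      = (Z - W) * X * (1 - V * Z) + (W - Z) * (X * (1 - V * W) - 1)
          + Z * ((1 - V * W) * X - 1) * V * (Z - W) := by noncomm_ring
    _ = (Z - W) * X * (1 - V * Z) := by simp [hX, hX']

theorem mobius_norm_identity (hS : S = 1 + W * X * V) (hX' : (1 - V * W) * X = 1)
    (hX : X * (1 - V * W) = 1) (Z Y : R) :
    (1 - Y * W) * X * (1 - V * Z) - (Y - V) * S * (Z - W) = 1 - Y * Z := by
  subst hS
  calc (1 - Y * W) * X * (1 - V * Z) - (Y - V) * (1 + W * X * V) * (Z - W)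
      = 1 - Y * Z + (1 - Y * W) * (X * (1 - V * W) - 1)
          - ((1 - V * W) * X - 1) * V * (Z - W) := by noncomm_ring
    _ = 1 - Y * Z := by simp [hX, hX']

end Ring

/-- For `Z, Z₀ ∈ R_II(p)` and `A` with `Āᵗ * A = (I - Z₀ * Z₀ᴴ)⁻¹`, the matrix
`Z* = A * (Z - Z₀) * (I - Z₀ᴴ * Z)⁻¹ * Ā⁻¹` again belongs to `R_II(p)`;
moreover `Z* = 0` when `Z = Z₀`. -/
theorem transform_mem_RII (p : ℕ) (Z Z₀ A : Matrix (Fin p) (Fin p) ℂ)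
    (hZ : RII p Z) (hZ₀ : RII p Z₀)
    (hA : Aᴴ * A = (1 - Z₀ * Z₀ᴴ)⁻¹)
    (Zs : Matrix (Fin p) (Fin p) ℂ)
    (hZs : Zs = A * (Z - Z₀) * (1 - Z₀ᴴ * Z)⁻¹ * (A.map (starRingEnd ℂ))⁻¹) :
    RII p Zs ∧ (Z = Z₀ → Zs = 0) := by
  obtain ⟨hZsymm, hZpos⟩ := hZ
  obtain ⟨hWsymm, hWpos⟩ := hZ₀
  refine ⟨?_, fun h => by simp [hZs, h]⟩
  have hZt : Zᵀ = Z := hZsymm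
  have hWt : Z₀ᵀ = Z₀ := hWsymm
  have hWHt : Z₀ᴴᵀ = Z₀ᴴ := hWsymm.conjTranspose
  have hZHt : Zᴴᵀ = Zᴴ := hZsymm.conjTranspose
  set B := A.map (starRingEnd ℂ) with hB
  have hBt : Bᵀ = Aᴴ := rfl
  have hBH : Bᴴ = Aᵀ := by ext i j; simp [hB]
  set M := 1 - Z₀ᴴ * Z with hM
  have hMt : Mᵀ = 1 - Z * Z₀ᴴ := by simp [hM, transpose_sub, hZt, hWHt]
  have hMH : Mᴴ = 1 - Zᴴ * Z₀ := by simp [hM, conjTranspose_sub]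
  have hS : (Aᴴ * A) * (1 - Z₀ * Z₀ᴴ) = 1 := by
    rw [hA, nonsing_inv_mul _ ((isUnit_iff_isUnit_det _).1 hWpos.isUnit)]
  have hX' : (1 - Z₀ᴴ * Z₀) * (Aᵀ * B) = 1 := by
    have h := congrArg Matrix.transpose hS
    simpa [transpose_mul, transpose_sub, hWt, hWHt, ← hBt] using h
  have hX : (Aᵀ * B) * (1 - Z₀ᴴ * Z₀) = 1 := mul_eq_one_comm.1 hX'
  have hSX := inv_one_sub_mul_eq hS hX'
  have hsymm := mobius_symm_identity hSX hX' hX Z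
  have hnorm := mobius_norm_identity hSX hX' hX Z Zᴴ
  rw [← hMt, ← hM] at hsymm
  rw [← hMH, ← hM, ← hBH, ← conjTranspose_sub] at hnorm
  have hZpos' : (1 - Zᴴ * Z).PosDef := by
    simpa [transpose_sub, transpose_mul, hZt, hZHt] using hZpos.transpose
  have hBM : (B * M)ᴴ * (B * M) - (A * (Z - Z₀))ᴴ * (A * (Z - Z₀)) = 1 - Zᴴ * Z := by
    rw [← hnorm]; simp only [conjTranspose_mul, Matrix.mul_assoc]
  have hunit : IsUnit (B * M) := by
    have h := (hZpos'.add_posSemidef (posSemidef_conjTranspose_mul_self (A * (Z - Z₀)))).isUnit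
    rw [← hBM, sub_add_cancel] at h
    exact isUnit_of_mul_isUnit_right h
  have hdet := (isUnit_iff_isUnit_det _).1 hunit
  have hR : B * M * (B * M)⁻¹ = 1 := mul_nonsing_inv _ hdet
  have hZs' : Zs = A * (Z - Z₀) * (B * M)⁻¹ := by
    rw [hZs, Matrix.mul_inv_rev, Matrix.mul_assoc _ M⁻¹]
  set T := (B * M)⁻¹
  have hTt : Tᵀ * (Mᵀ * Bᵀ) = 1 := by
    rw [← transpose_mul, ← transpose_mul, hR, transpose_one]
  have hZsT : Zsᵀ = Zs := by
    calc Zsᵀ = Tᵀ * ((Z - Z₀) * Aᵀ) * (B * M * T) := by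
          rw [hR, hZs']; simp [transpose_mul, transpose_sub, hZt, hWt, Matrix.mul_assoc]
      _ = Tᵀ * ((Z - Z₀) * (Aᵀ * B) * M) * T := by simp only [Matrix.mul_assoc]
      _ = Tᵀ * (Mᵀ * Bᵀ) * (A * (Z - Z₀) * T) := by
          rw [← hsymm, hBt]; simp only [Matrix.mul_assoc]
      _ = Zs := by rw [hTt, hZs', Matrix.one_mul]
  have hZsHt : Zsᴴᵀ = Zsᴴ := IsSymm.conjTranspose hZsT
  have hpos : (1 - Zsᴴ * Zs).PosDef := by
    have h : 1 - Zsᴴ * Zs = Tᴴ * (1 - Zᴴ * Z) * T := by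
      have h1 : (1 : Matrix (Fin p) (Fin p) ℂ) = (B * M * T)ᴴ * (B * M * T) := by simp [hR]
      rw [← hBM, hZs']
      nth_rw 1 [h1]
      simp only [conjTranspose_mul, conjTranspose_sub, Matrix.mul_sub,
        Matrix.sub_mul, Matrix.mul_assoc]
    rw [h]
    exact hZpos'.conjTranspose_mul_mul_same
      (mulVec_injective_of_isUnit (isUnit_nonsing_inv_iff.2 hunit))
  refine ⟨hZsT, ?_⟩
  simpa [transpose_sub, transpose_mul, hZsT, hZsHt] using hpos.transpose
end

section
/- Let p > 1 and r ≥ 1 be integers and K = p/2 + 1/(p+1). Let Y ≥ 1 be a real number, let dZ be a p×p complex symmetric matrix, and let w, dw ∈ ℂ^r, not all of dZ and dw zero (i.e. s + |dw|² > 0 where s = tr(dZ·(dZ)ᴴ)). Then the holomorphic sectional curvature expression ω = −2 + (2K^{−2}·Y·s² − 2K^{−1}·Y·t) / (K^{−1}·Y·s + Y²·|Σ_i w̄_i·dw_i|² + Y·|dw|²)², where t = tr((dZ·(dZ)ᴴ)²), satisfies −2K ≤ ω ≤ −2K/p. -/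
open Matrix

/-- The squared norm `|dw|² = Σ_i |dw_i|²` of a vector in `ℂʳ`. -/
def nsq {r : ℕ} (w : Fin r → ℂ) : ℝ := ∑ i, Complex.normSq (w i)

theorem re_trace_mul_conjTranspose_self {m n : Type*} [Fintype m] [Fintype n]
    (A : Matrix m n ℂ) :
    (trace (A * Aᴴ)).re = ∑ i, ∑ j, Complex.normSq (A i j) := by
  simp [trace, mul_apply, Complex.mul_conj]

theorem normSq_mul_conjTranspose_apply_le {m n : Type*} [Fintype n]
    (A : Matrix m n ℂ) (i j : m) :
    Complex.normSq ((A * Aᴴ) i j) ≤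
      (∑ k, Complex.normSq (A i k)) * ∑ k, Complex.normSq (A j k) := by
  have h : ‖(A * Aᴴ) i j‖ ≤ ∑ k, ‖A i k‖ * ‖A j k‖ := by
    rw [mul_apply]
    exact (norm_sum_le _ _).trans_eq (by simp)
  simp only [Complex.normSq_eq_norm_sq]
  exact (pow_le_pow_left₀ (norm_nonneg _) h 2).trans
    (Finset.sum_mul_sq_le_sq_mul_sq _ _ _)

theorem re_trace_gram_sq {m n : Type*} [Fintype m] [DecidableEq m] [Fintype n]
    (A : Matrix m n ℂ) :
    (trace ((A * Aᴴ) ^ 2)).re = ∑ i, ∑ j, Complex.normSq ((A * Aᴴ) i j) := by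
  rw [← re_trace_mul_conjTranspose_self, (isHermitian_mul_conjTranspose_self A).eq, sq]

theorem re_trace_gram_sq_le {m n : Type*} [Fintype m] [DecidableEq m] [Fintype n]
    (A : Matrix m n ℂ) :
    (trace ((A * Aᴴ) ^ 2)).re ≤ (trace (A * Aᴴ)).re ^ 2 := by
  rw [re_trace_gram_sq, re_trace_mul_conjTranspose_self, sq, Finset.sum_mul_sum]
  exact Finset.sum_le_sum fun i _ => Finset.sum_le_sum fun j _ =>
    normSq_mul_conjTranspose_apply_le A i j

theorem sq_re_trace_gram_le {m n : Type*} [Fintype m] [DecidableEq m] [Fintype n]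
    (A : Matrix m n ℂ) :
    (trace (A * Aᴴ)).re ^ 2 ≤ Fintype.card m * (trace ((A * Aᴴ) ^ 2)).re := by
  rw [re_trace_gram_sq, trace, Complex.re_sum]
  refine sq_sum_le_card_mul_sum_sq.trans ?_
  rw [Finset.card_univ]
  refine mul_le_mul_of_nonneg_left (Finset.sum_le_sum fun i _ => ?_) (Nat.cast_nonneg _)
  refine le_trans ?_ (Finset.single_le_sum
    (f := fun j => Complex.normSq ((A * Aᴴ) i j)) (fun j _ => Complex.normSq_nonneg _)
    (Finset.mem_univ i))
  rw [diag_apply, Complex.normSq_apply, sq]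
  exact le_add_of_nonneg_right (mul_self_nonneg _)

/-- **Estimate of the holomorphic sectional curvature.** For `p > 1`, `K = p/2 + 1/(p+1)`,
`Y ≥ 1`, a symmetric direction `dZ` and fiber direction `dw` (not both zero), putting
`s = tr(dZ dZᴴ)`, `t = tr((dZ dZᴴ)²)`, the curvature
`ω = -2 + (2K⁻²Y s² - 2K⁻¹Y t) / (K⁻¹Y s + Y²|Σ w̄ᵢ dwᵢ|² + Y|dw|²)²`
satisfies `-2K ≤ ω ≤ -2K/p`. -/
theorem curvature_estimate (p r : ℕ) (hp : 1 < p) (hr : 1 ≤ r)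
    (K : ℝ) (hK : K = (p : ℝ) / 2 + 1 / ((p : ℝ) + 1))
    (Y : ℝ) (hY : 1 ≤ Y)
    (dZ : Matrix (Fin p) (Fin p) ℂ) (hdZ : dZ.IsSymm)
    (w dw : Fin r → ℂ)
    (s t : ℝ)
    (hs : s = (Matrix.trace (dZ * dZᴴ)).re)
    (ht : t = (Matrix.trace ((dZ * dZᴴ) ^ 2)).re)
    (hnz : 0 < s + nsq dw)
    (ω : ℝ)
    (hω : ω = -2 + (2 * K⁻¹ ^ 2 * Y * s ^ 2 - 2 * K⁻¹ * Y * t) /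
      (K⁻¹ * Y * s + Y ^ 2 * Complex.normSq (∑ i, (starRingEnd ℂ) (w i) * dw i) +
        Y * nsq dw) ^ 2) :
    -2 * K ≤ ω ∧ ω ≤ -2 * K / p := by
  have hs0 : 0 ≤ s := by
    rw [hs, re_trace_mul_conjTranspose_self]
    exact Finset.sum_nonneg fun i _ => Finset.sum_nonneg fun j _ => Complex.normSq_nonneg _
  have hts : t ≤ s ^ 2 := hs ▸ ht ▸ re_trace_gram_sq_le dZ
  have hst : s ^ 2 ≤ p * t := by
    simpa [← hs, ← ht] using sq_re_trace_gram_le dZ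
  have hn0 : 0 ≤ nsq dw := Finset.sum_nonneg fun i _ => Complex.normSq_nonneg _
  have hq0 := Complex.normSq_nonneg (∑ i, (starRingEnd ℂ) (w i) * dw i)
  generalize Complex.normSq (∑ i, (starRingEnd ℂ) (w i) * dw i) = q at hq0 hω
  generalize nsq dw = n at hn0 hnz hω
  have hp2 : (2 : ℝ) ≤ p := by exact_mod_cast hp
  have hK1 : 1 ≤ K := by
    have h : K - 1 = p * (p - 1) / (2 * (p + 1)) := by rw [hK]; field_simp; ring
    have : 0 ≤ (p : ℝ) * (p - 1) / (2 * (p + 1)) :=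
      div_nonneg (mul_nonneg (by linarith) (by linarith)) (by linarith)
    linarith
  have hKp : K ≤ p := by
    have : 1 / ((p : ℝ) + 1) ≤ 1 := by rw [div_le_one (by linarith)]; linarith
    linarith
  have hK0 : 0 < K := by linarith
  have hp0 : (0 : ℝ) < p := by linarith
  have hY0 : 0 < Y := by linarith
  set D := K⁻¹ * Y * s + Y ^ 2 * q + Y * n with hD
  have hKD : K * D = Y * s + K * (Y ^ 2 * q + Y * n) := by rw [hD]; field_simp; ring
  have hKD0 : 0 < K * D := by
    have hq : 0 ≤ K * (Y ^ 2 * q) := by positivity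
    have hn : Y * n ≤ K * (Y * n) := le_mul_of_one_le_left (by positivity) hK1
    have := mul_pos hY0 hnz
    linarith
  have hle : Y * s ≤ K * D := by
    rw [hKD]
    exact le_add_of_nonneg_right (by positivity)
  have hsq : Y * s ^ 2 ≤ (K * D) ^ 2 := calc
    Y * s ^ 2 ≤ Y * (Y * s ^ 2) := le_mul_of_one_le_left (by positivity) hY
    _ = (Y * s) ^ 2 := by ring
    _ ≤ (K * D) ^ 2 := pow_le_pow_left₀ (by positivity) hle 2
  have hD0 : D ≠ 0 := (pos_of_mul_pos_right hKD0 hK0.le).ne'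
  have hω' : ω = -2 + 2 * (Y * (s ^ 2 - K * t) / (K * D) ^ 2) := by
    rw [hω]; field_simp
  have hpos : 0 < (K * D) ^ 2 := pow_pos hKD0 2
  constructor
  · have : 1 - K ≤ Y * (s ^ 2 - K * t) / (K * D) ^ 2 := by
      rw [le_div_iff₀ hpos]
      have h1 := mul_le_mul_of_nonneg_left hts (mul_pos hY0 hK0).le
      have h2 := mul_le_mul_of_nonneg_left hsq (sub_nonneg.2 hK1)
      linarith
    linarith
  · have : Y * (s ^ 2 - K * t) / (K * D) ^ 2 ≤ 1 - K / p := by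
      rw [div_le_iff₀ hpos]
      have hKp' : 0 ≤ 1 - K / p := sub_nonneg.2 ((div_le_one hp0).2 hKp)
      have h1 : K / p * s ^ 2 ≤ K * t := by
        rw [div_mul_eq_mul_div, div_le_iff₀ hp0, mul_assoc, mul_comm t]
        exact mul_le_mul_of_nonneg_left hst hK0.le
      have h2 := mul_le_mul_of_nonneg_left h1 hY0.le
      have h3 := mul_le_mul_of_nonneg_left hsq hKp'
      linarith
    have h : -2 * K / p = -2 * (K / p) := by ring
    linarith
end

section
/- Let p > 1 and r ≥ 1 be integers and K = p/2 + 1/(p+1). Let dZ be a nonzero p×p complex symmetric matrix satisfying p·t = s², where s = tr(dZ·(dZ)ᴴ) and t = tr((dZ·(dZ)ᴴ)²) (e.g. dZ = λ·I with λ > 0). Then with Y = 1, dw = 0, and any w ∈ ℂ^r, the holomorphic sectional curvature expression ω = −2 + (2K^{−2}·Y·s² − 2K^{−1}·Y·t)/(K^{−1}·Y·s + Y²·|Σ_i w̄_i·dw_i|² + Y·|dw|²)² equals exactly −2K/p; hence the upper bound −2K/p in the curvature estimate is attained and the estimate is sharp. -/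
open Matrix

open scoped ComplexOrder in
/-- The squared Frobenius norm of a nonzero complex matrix does not vanish. -/
theorem re_trace_mul_conjTranspose_self_ne_zero {m n : Type*} [Fintype m] [Fintype n]
    {A : Matrix m n ℂ} (hA : A ≠ 0) : (Matrix.trace (A * Aᴴ)).re ≠ 0 := by
  have him : (Matrix.trace (A * Aᴴ)).im = 0 :=
    (Complex.nonneg_iff.mp (posSemidef_self_mul_conjTranspose A).trace_nonneg).2.symm
  exact fun hre => hA (trace_mul_conjTranspose_self_eq_zero_iff.mp (Complex.ext hre him))

/-- **Sharpness of the upper bound `-2K/p`.** For `p > 1`, `K = p/2 + 1/(p+1)`, a nonzero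
symmetric direction `dZ` with `p·t = s²` (e.g. `dZ = λ I`, `λ > 0`), `Y = 1` and
`dw = 0`, the holomorphic sectional curvature expression equals exactly `-2K/p`. -/
theorem curvature_upper_bound_sharp (p r : ℕ) (hp : 1 < p) (hr : 1 ≤ r)
    (K : ℝ) (hK : K = (p : ℝ) / 2 + 1 / ((p : ℝ) + 1))
    (dZ : Matrix (Fin p) (Fin p) ℂ) (hdZ : dZ.IsSymm) (hne : dZ ≠ 0)
    (s t : ℝ)
    (hs : s = (Matrix.trace (dZ * dZᴴ)).re)
    (ht : t = (Matrix.trace ((dZ * dZᴴ) ^ 2)).re)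
    (hts : (p : ℝ) * t = s ^ 2)
    (Y : ℝ) (hY : Y = 1)
    (dw : Fin r → ℂ) (hdw : dw = 0)
    (w : Fin r → ℂ) :
    -2 + (2 * K⁻¹ ^ 2 * Y * s ^ 2 - 2 * K⁻¹ * Y * t) /
      (K⁻¹ * Y * s + Y ^ 2 * Complex.normSq (∑ i, (starRingEnd ℂ) (w i) * dw i) +
        Y * nsq dw) ^ 2 = -2 * K / p := by
  have hs0 : s ≠ 0 := hs ▸ re_trace_mul_conjTranspose_self_ne_zero hne
  have hp0 : (0 : ℝ) < p := by exact_mod_cast zero_lt_one.trans hp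
  have hK0 : K ≠ 0 := by
    rw [hK]
    positivity
  have ht' : t = s ^ 2 / p := by
    rw [← hts]
    field_simp
  have hnsq : nsq (0 : Fin r → ℂ) = 0 := by simp [nsq]
  subst hY hdw
  simp only [hnsq, ht', Pi.zero_apply, mul_zero, Finset.sum_const_zero, map_zero, add_zero]
  field_simp
  ring
end

section
/- Let p > 1 and r ≥ 1 be integers, K = p/2 + 1/(p+1), h = p(p+1)/2 + 1, and let b₀, …, b_h be real numbers with b_h > 0. Define G(Y) = Σ_{j=0}^{h} b_j·(r+j−1)!·Y^{r+j}, G₁(Y) = Σ_{j=0}^{h} b_j·(r+j)!·Y^{r+j+1}, G₂(Y) = Σ_{j=0}^{h} b_j·(r+j+1)!·Y^{r+j+2}, H' = G₁/G, H'' = G₂/G − (G₁/G)². Assume that for every X ∈ [0,1), with Y = (1−X)^{−1}, one has G(Y) > 0, H'(Y) > 0, H'(Y) + H''(Y)·X > 0, and (1/K)·H'(Y)·X + p + 1 + r/K > 0. Then there exist real constants a ≥ b > 0 such that for all X ∈ [0,1) and Y = (1−X)^{−1}: b·(Y/K) ≤ (1/K)·H'(Y)·X + p + 1 + r/K ≤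 a·(Y/K), b·(Y + Y²·X) ≤ H'(Y) + H''(Y)·X ≤ a·(Y + Y²·X), and b·Y ≤ H'(Y) ≤ a·Y. Consequently the Bergman metric of Y_II(r,p;K) satisfies b·E_II ≤ B_II ≤ a·E_II, i.e. it is equivalent to the complete Einstein–Kähler metric. -/
/-- `G(Y) = Σ_{j=0}^{h} b_j Γ(r+j) Y^{r+j}`, the polynomial in the Bergman kernel of
the Cartan–Hartogs domain `Y_II(r,p;K)`. -/
noncomputable def Gpoly (r h : ℕ) (b : ℕ → ℝ) (Y : ℝ) : ℝ :=
  ∑ j ∈ Finset.range (h + 1), b j * (Nat.factorial (r + j - 1) : ℝ) * Y ^ (r + j)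

/-- `G₁ = dG/dX` under `Y = (1-X)⁻¹`: `G₁(Y) = Σ_{j=0}^{h} b_j Γ(r+j+1) Y^{r+j+1}`. -/
noncomputable def G1poly (r h : ℕ) (b : ℕ → ℝ) (Y : ℝ) : ℝ :=
  ∑ j ∈ Finset.range (h + 1), b j * (Nat.factorial (r + j) : ℝ) * Y ^ (r + j + 1)

/-- `G₂ = d²G/dX²` under `Y = (1-X)⁻¹`: `G₂(Y) = Σ_{j=0}^{h} b_j Γ(r+j+2) Y^{r+j+2}`. -/
noncomputable def G2poly (r h : ℕ) (b : ℕ → ℝ) (Y : ℝ) : ℝ :=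
  ∑ j ∈ Finset.range (h + 1), b j * (Nat.factorial (r + j + 1) : ℝ) * Y ^ (r + j + 2)

/-- `H' = G₁/G`, where `H = log G`. -/
noncomputable def Hp (r h : ℕ) (b : ℕ → ℝ) (Y : ℝ) : ℝ :=
  G1poly r h b Y / Gpoly r h b Y

/-- `H'' = G₂/G - (G₁/G)²`, where `H = log G`. -/
noncomputable def Hpp (r h : ℕ) (b : ℕ → ℝ) (Y : ℝ) : ℝ :=
  G2poly r h b Y / Gpoly r h b Y - (G1poly r h b Y / Gpoly r h b Y) ^ 2

/-- The polynomial `∑_{j ≤ h} c_j t^{h-j}`, with the coefficients of `∑_{j ≤ h} c_j Y^j`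
in reverse order. -/
noncomputable def reversedSum (h : ℕ) (c : ℕ → ℝ) (t : ℝ) : ℝ :=
  ∑ j ∈ Finset.range (h + 1), c j * t ^ (h - j)

theorem continuous_reversedSum (h : ℕ) (c : ℕ → ℝ) : Continuous (reversedSum h c) := by
  unfold reversedSum
  fun_prop

theorem reversedSum_zero (h : ℕ) (c : ℕ → ℝ) : reversedSum h c 0 = c h := by
  unfold reversedSum
  rw [Finset.sum_range_succ, Finset.sum_eq_zero, Nat.sub_self, pow_zero, mul_one, zero_add]
  intro j hj
  have : h - j ≠ 0 := by
    have := Finset.mem_range.mp hj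
    omega
  rw [zero_pow this, mul_zero]

theorem sum_mul_inv_pow_eq (m h : ℕ) (c : ℕ → ℝ) {t : ℝ} (ht : t ≠ 0) :
    ∑ j ∈ Finset.range (h + 1), c j * t⁻¹ ^ (m + j) = t⁻¹ ^ (m + h) * reversedSum h c t := by
  unfold reversedSum
  rw [Finset.mul_sum]
  refine Finset.sum_congr rfl fun j hj => ?_
  have hsplit : m + h = (m + j) + (h - j) := by
    have := Finset.mem_range.mp hj
    omega
  have hcancel : t⁻¹ ^ (h - j) * t ^ (h - j) = 1 := by
    rw [← mul_pow, inv_mul_cancel₀ ht, one_pow]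
  rw [hsplit, pow_add]
  linear_combination (-(c j * t⁻¹ ^ (m + j))) * hcancel

/-- A continuous function that is positive on a nonempty compact set is bounded there between
two positive constants. -/
theorem exists_pos_bounds_of_continuousOn {α : Type*} [TopologicalSpace α] {s : Set α}
    (hs : IsCompact s) (hne : s.Nonempty) {f : α → ℝ} (hf : ContinuousOn f s)
    (hfpos : ∀ x ∈ s, 0 < f x) :
    ∃ a c : ℝ, 0 < c ∧ ∀ x ∈ s, c ≤ f x ∧ f x ≤ a := by
  obtain ⟨u, hu, hmin⟩ := hs.exists_isMinOn hne hf
  obtain ⟨v, -, hmax⟩ := hs.exists_isMaxOn hne hf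
  exact ⟨f v, f u, hfpos u hu, fun x hx => ⟨hmin hx, hmax hx⟩⟩

/-- **Equivalence of the Bergman and Einstein–Kähler metrics on `Y_II(r,p;K)` for
`K = p/2 + 1/(p+1)`.** There are constants `a ≥ c > 0` such that, for all
`X ∈ [0,1)` and `Y = (1-X)⁻¹`, the three coefficient ratios of the Bergman metric
`B_II = ((1/K)H'X + p+1+r/K)|dZ|² + (H'+H''X)|dw|² + H'|dW|²` to the Einstein–Kähler
metric `E_II = (Y/K)|dZ|² + (Y+Y²X)|dw|² + Y|dW|²` lie between `c` and `a`; i.e.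
`c·E_II ≤ B_II ≤ a·E_II`. -/
theorem bergman_equiv_einstein_kahler (p r : ℕ) (hp : 1 < p) (hr : 1 ≤ r)
    (K : ℝ) (hK : K = (p : ℝ) / 2 + 1 / ((p : ℝ) + 1))
    (h : ℕ) (hh : h = p * (p + 1) / 2 + 1)
    (b : ℕ → ℝ) (hbh : 0 < b h)
    (hpos : ∀ X : ℝ, X ∈ Set.Ico (0 : ℝ) 1 →
      0 < Gpoly r h b (1 - X)⁻¹ ∧
      0 < Hp r h b (1 - X)⁻¹ ∧
      0 < Hp r h b (1 - X)⁻¹ + Hpp r h b (1 - X)⁻¹ * X ∧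
      0 < (1 / K) * Hp r h b (1 - X)⁻¹ * X + (p : ℝ) + 1 + (r : ℝ) / K) :
    ∃ a c : ℝ, 0 < c ∧ c ≤ a ∧
      ∀ X : ℝ, X ∈ Set.Ico (0 : ℝ) 1 → ∀ Y : ℝ, Y = (1 - X)⁻¹ →
        (c * (Y / K) ≤ (1 / K) * Hp r h b Y * X + (p : ℝ) + 1 + (r : ℝ) / K ∧
          (1 / K) * Hp r h b Y * X + (p : ℝ) + 1 + (r : ℝ) / K ≤ a * (Y / K)) ∧
        (c * (Y + Y ^ 2 * X) ≤ Hp r h b Y + Hpp r h b Y * X ∧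
          Hp r h b Y + Hpp r h b Y * X ≤ a * (Y + Y ^ 2 * X)) ∧
        (c * Y ≤ Hp r h b Y ∧ Hp r h b Y ≤ a * Y) := by
  have hKpos : 0 < K := by rw [hK]; positivity
  set g := reversedSum h fun j => b j * (Nat.factorial (r + j - 1) : ℝ) with hg
  set g₁ := reversedSum h fun j => b j * (Nat.factorial (r + j) : ℝ) with hg₁
  set g₂ := reversedSum h fun j => b j * (Nat.factorial (r + j + 1) : ℝ) with hg₂
  have hgc : Continuous g := continuous_reversedSum _ _
  have hg₁c : Continuous g₁ := continuous_reversedSum _ _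
  have hg₂c : Continuous g₂ := continuous_reversedSum _ _
  have hG : ∀ t : ℝ, t ≠ 0 → Gpoly r h b t⁻¹ = t⁻¹ ^ (r + h) * g t := fun t ht =>
    sum_mul_inv_pow_eq r h _ ht
  have hG₁ : ∀ t : ℝ, t ≠ 0 → G1poly r h b t⁻¹ = t⁻¹ ^ (r + h) * t⁻¹ * g₁ t := by
    intro t ht
    have := sum_mul_inv_pow_eq (r + 1) h (fun j => b j * (Nat.factorial (r + j) : ℝ)) ht
    simp only [add_right_comm r 1] at this
    rw [G1poly, this, pow_succ]
  have hG₂ : ∀ t : ℝ, t ≠ 0 → G2poly r h b t⁻¹ = t⁻¹ ^ (r + h) * t⁻¹ ^ 2 * g₂ t := by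
    intro t ht
    have := sum_mul_inv_pow_eq (r + 2) h (fun j => b j * (Nat.factorial (r + j + 1) : ℝ)) ht
    simp only [add_right_comm r 2] at this
    rw [G2poly, this, pow_add]
  have hHp : ∀ t : ℝ, t ≠ 0 → Hp r h b t⁻¹ = t⁻¹ * (g₁ t / g t) := by
    intro t ht
    have hpow : t⁻¹ ^ (r + h) ≠ 0 := pow_ne_zero _ (inv_ne_zero ht)
    rw [Hp, hG t ht, hG₁ t ht, mul_assoc, mul_div_mul_left _ _ hpow, mul_div_assoc]
  have hHpp : ∀ t : ℝ, t ≠ 0 →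
      Hpp r h b t⁻¹ = t⁻¹ ^ 2 * (g₂ t / g t - (g₁ t / g t) ^ 2) := by
    intro t ht
    have hpow : t⁻¹ ^ (r + h) ≠ 0 := pow_ne_zero _ (inv_ne_zero ht)
    have hHp' := hHp t ht
    rw [Hp] at hHp'
    rw [Hpp, hHp', hG t ht, hG₂ t ht, mul_assoc, mul_div_mul_left _ _ hpow]
    ring
  have hpos' : ∀ t ∈ Set.Ioc (0 : ℝ) 1,
      0 < Gpoly r h b t⁻¹ ∧ 0 < Hp r h b t⁻¹ ∧
      0 < Hp r h b t⁻¹ + Hpp r h b t⁻¹ * (1 - t) ∧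
      0 < (1 / K) * Hp r h b t⁻¹ * (1 - t) + (p : ℝ) + 1 + (r : ℝ) / K := by
    intro t ht
    simpa only [sub_sub_cancel] using
      hpos (1 - t) ⟨by linarith [ht.2], by linarith [ht.1]⟩
  have hn : (0 : ℝ) < r + h := by
    have : (1 : ℝ) ≤ r := by exact_mod_cast hr
    positivity
  have hg0 : 0 < g 0 := by
    rw [hg, reversedSum_zero]
    positivity
  have hratio₁ : g₁ 0 / g 0 = r + h := by
    rw [div_eq_iff hg0.ne', hg, hg₁, reversedSum_zero, reversedSum_zero,
      ← Nat.mul_factorial_pred (by omega : r + h ≠ 0)]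
    push_cast
    ring
  have hratio₂ : g₂ 0 / g 0 = (r + h + 1) * (r + h) := by
    rw [div_eq_iff hg0.ne', hg, hg₂, reversedSum_zero, reversedSum_zero, Nat.factorial_succ,
      ← Nat.mul_factorial_pred (by omega : r + h ≠ 0)]
    push_cast
    ring
  -- The coefficient ratios of the two metrics, as functions of `t = 1 - X = Y⁻¹`.
  let ratioZ : ℝ → ℝ := fun t => g₁ t / g t * (1 - t) + (K * (p + 1) + r) * t
  let ratiow : ℝ → ℝ := fun t => g₁ t / g t * t + (g₂ t / g t - (g₁ t / g t) ^ 2) * (1 - t)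
  let ratioW : ℝ → ℝ := fun t => g₁ t / g t
  have hgpos : ∀ t ∈ Set.Icc (0 : ℝ) 1, 0 < g t := by
    intro t ht
    rcases ht.1.eq_or_lt with rfl | ht0
    · exact hg0
    · have := (hpos' t ⟨ht0, ht.2⟩).1
      rw [hG t ht0.ne'] at this
      exact pos_of_mul_pos_right this (by positivity)
  have hq₁ : ContinuousOn (fun t => g₁ t / g t) (Set.Icc 0 1) :=
    hg₁c.continuousOn.div hgc.continuousOn fun t ht => (hgpos t ht).ne'
  have hq₂ : ContinuousOn (fun t => g₂ t / g t) (Set.Icc 0 1) :=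
    hg₂c.continuousOn.div hgc.continuousOn fun t ht => (hgpos t ht).ne'
  have hZ : ∀ t : ℝ, t ≠ 0 → (1 / K) * Hp r h b t⁻¹ * (1 - t) + (p : ℝ) + 1 + (r : ℝ) / K =
      ratioZ t * (t⁻¹ / K) := by
    intro t ht
    simp only [ratioZ, hHp t ht]
    generalize g₁ t / g t = q
    field_simp
    ring
  have hw : ∀ t : ℝ, t ≠ 0 → Hp r h b t⁻¹ + Hpp r h b t⁻¹ * (1 - t) =
      ratiow t * (t⁻¹ + t⁻¹ ^ 2 * (1 - t)) := by
    intro t ht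
    simp only [ratiow, hHp t ht, hHpp t ht]
    generalize g₁ t / g t = q
    generalize g₂ t / g t = q'
    field_simp
    ring
  have hW : ∀ t : ℝ, t ≠ 0 → Hp r h b t⁻¹ = ratioW t * t⁻¹ := fun t ht => by
    rw [hHp t ht, mul_comm]
  have hwpos : ∀ t ∈ Set.Ioc (0 : ℝ) 1, 0 < t⁻¹ + t⁻¹ ^ 2 * (1 - t) := by
    intro t ht
    have := inv_pos.mpr ht.1
    have : 0 ≤ 1 - t := sub_nonneg.mpr ht.2
    positivity
  have hcompact : IsCompact (Set.Icc (0 : ℝ) 1) := isCompact_Icc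
  have hne : (Set.Icc (0 : ℝ) 1).Nonempty := ⟨0, by simp⟩
  obtain ⟨aZ, cZ, hcZ, hboundZ⟩ := exists_pos_bounds_of_continuousOn hcompact hne
    (f := ratioZ) (by fun_prop) fun t ht => by
      rcases ht.1.eq_or_lt with rfl | ht0
      · simpa [ratioZ, hratio₁] using hn
      · have := (hpos' t ⟨ht0, ht.2⟩).2.2.2
        rw [hZ t ht0.ne'] at this
        exact pos_of_mul_pos_left this (by positivity)
  obtain ⟨aw, cw, hcw, hboundw⟩ := exists_pos_bounds_of_continuousOn hcompact hne
    (f := ratiow) (by fun_prop) fun t ht => by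
      rcases ht.1.eq_or_lt with rfl | ht0
      · simp only [ratiow, hratio₁, hratio₂]
        linarith
      · have := (hpos' t ⟨ht0, ht.2⟩).2.2.1
        rw [hw t ht0.ne'] at this
        exact pos_of_mul_pos_left this (hwpos t ⟨ht0, ht.2⟩).le
  obtain ⟨aW, cW, hcW, hboundW⟩ := exists_pos_bounds_of_continuousOn hcompact hne
    (f := ratioW) hq₁ fun t ht => by
      rcases ht.1.eq_or_lt with rfl | ht0
      · simpa only [ratioW, hratio₁] using hn
      · have := (hpos' t ⟨ht0, ht.2⟩).2.1
        rw [hW t ht0.ne'] at this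
        exact pos_of_mul_pos_left this (by positivity)
  refine ⟨max aZ (max aw aW), min cZ (min cw cW), by positivity, ?_, ?_⟩
  · obtain ⟨hl, hu⟩ := hboundZ 0 (by simp)
    exact (min_le_left _ _).trans ((hl.trans hu).trans (le_max_left _ _))
  · rintro X ⟨hX0, hX1⟩ Y rfl
    obtain ⟨t, rfl⟩ : ∃ t, X = 1 - t := ⟨1 - X, by ring⟩
    have ht : t ∈ Set.Ioc (0 : ℝ) 1 := ⟨by linarith, by linarith⟩
    have ht0 : t ≠ 0 := ht.1.ne'
    have htI : t ∈ Set.Icc (0 : ℝ) 1 := ⟨ht.1.le, ht.2⟩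
    have hYpos : 0 < t⁻¹ := inv_pos.mpr ht.1
    have hYKpos : 0 < t⁻¹ / K := div_pos hYpos hKpos
    have hYw := hwpos t ht
    rw [sub_sub_cancel, hZ t ht0, hw t ht0, hW t ht0]
    refine ⟨⟨?_, ?_⟩, ⟨?_, ?_⟩, ?_, ?_⟩ <;> gcongr
    · exact (min_le_left _ _).trans (hboundZ t htI).1
    · exact (hboundZ t htI).2.trans (le_max_left _ _)
    · exact ((min_le_right _ _).trans (min_le_left _ _)).trans (hboundw t htI).1
    · exact (hboundw t htI).2.trans ((le_max_left _ _).trans (le_max_right _ _))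
    · exact ((min_le_right _ _).trans (min_le_right _ _)).trans (hboundW t htI).1
    · exact (hboundW t htI).2.trans ((le_max_right _ _).trans (le_max_right _ _))
end
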